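/- Let R be a large ideal domain, r ∈ ℕ, F a finite set of polynomials over R with zero constant term, and R = C₁ ∪ ... ∪ C_r a finite coloring. Then there exist i ∈ {1,...,r} and infinitely many y ∈ R such that the set {x ∈ R : {xy} ∪ {x+f(y) : f ∈ F} ⊆ C_i} is piecewise syndetic in (R,+). -/

import Mathlib

/-- `A` is piecewise syndetic in the commutative semigroup `(S,+)`. -/
def PiecewiseSyndetic {S : Type*} [AddCommSemigroup S] (A : Set S) : Prop :=
  ∃ G : Finset S, ∀ F : Finset S, ∃ x : S, ∀ f ∈ F, ∃ t ∈ G, t + (f + x) ∈ A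

open Polynomial

/-- `A` is piecewise syndetic along windows contained in `T`: some finite union of translates of
`A`, intersected with `T`, is thick. -/
def RelPiecewiseSyndetic {S : Type*} [AddCommSemigroup S] (T A : Set S) : Prop :=
  ∃ G : Finset S, ∀ F : Finset S, ∃ x : S, ∀ f ∈ F, f + x ∈ T ∧ ∃ t ∈ G, t + (f + x) ∈ A

namespace RelPiecewiseSyndetic

theorem univ_iff {S : Type*} [AddCommSemigroup S] {A : Set S} :
    RelPiecewiseSyndetic Set.univ A ↔ PiecewiseSyndetic A := by
  simp [RelPiecewiseSyndetic, PiecewiseSyndetic]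

section Group

variable {R : Type*} [AddCommGroup R] {T A B : Set R}

theorem mono (h : RelPiecewiseSyndetic T A) (hAB : A ⊆ B) : RelPiecewiseSyndetic T B := by
  obtain ⟨G, hG⟩ := h
  refine ⟨G, fun F => ?_⟩
  obtain ⟨x, hx⟩ := hG F
  exact ⟨x, fun f hf => ⟨(hx f hf).1, (hx f hf).2.imp fun t ht => ⟨ht.1, hAB ht.2⟩⟩⟩

theorem mono_left {T' : Set R} (h : RelPiecewiseSyndetic T' A) (hT : T' ⊆ T) :
    RelPiecewiseSyndetic T A := by
  obtain ⟨G, hG⟩ := h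
  refine ⟨G, fun F => ?_⟩
  obtain ⟨x, hx⟩ := hG F
  exact ⟨x, fun f hf => ⟨hT (hx f hf).1, (hx f hf).2⟩⟩

theorem nonempty (h : RelPiecewiseSyndetic T A) : A.Nonempty := by
  obtain ⟨G, hG⟩ := h
  obtain ⟨x, hx⟩ := hG {0}
  obtain ⟨-, t, -, ht⟩ := hx 0 (by simp)
  exact ⟨_, ht⟩

theorem translate (h : RelPiecewiseSyndetic T A) (s : R) :
    RelPiecewiseSyndetic T {z | s + z ∈ A} := by
  classical
  obtain ⟨G, hG⟩ := h
  refine ⟨G.image (· - s), fun F => ?_⟩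
  obtain ⟨x, hx⟩ := hG F
  refine ⟨x, fun f hf => ⟨(hx f hf).1, ?_⟩⟩
  obtain ⟨t, ht, htA⟩ := (hx f hf).2
  refine ⟨t - s, Finset.mem_image_of_mem _ ht, ?_⟩
  have : s + (t - s + (f + x)) = t + (f + x) := by abel
  rwa [Set.mem_ofPred_eq, this]

theorem inter_left (h : RelPiecewiseSyndetic T A) : RelPiecewiseSyndetic T (A ∩ T) := by
  classical
  obtain ⟨G, hG⟩ := h
  refine ⟨G, fun F => ?_⟩
  obtain ⟨x, hx⟩ := hG (F ∪ Finset.image₂ (· + ·) G F)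
  refine ⟨x, fun f hf => ?_⟩
  obtain ⟨hT, t, ht, hA⟩ := hx f (Finset.mem_union_left _ hf)
  refine ⟨hT, t, ht, hA, ?_⟩
  have := (hx (t + f) (Finset.mem_union_right _ (Finset.mem_image₂_of_mem ht hf))).1
  rwa [add_assoc] at this

theorem union (h : RelPiecewiseSyndetic T (A ∪ B)) :
    RelPiecewiseSyndetic T A ∨ RelPiecewiseSyndetic T B := by
  classical
  by_cases hB : RelPiecewiseSyndetic T B
  · exact Or.inr hB
  left
  obtain ⟨G, hG⟩ := h
  unfold RelPiecewiseSyndetic at hB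
  push Not at hB
  refine ⟨G, fun F => ?_⟩
  obtain ⟨K, hK⟩ := hB (Finset.image₂ (· + ·) G F)
  obtain ⟨x, hx⟩ := hG (K ∪ Finset.image₂ (· + ·) F K)
  obtain ⟨k, hk, hkB⟩ := hK x
  specialize hkB (hx k (Finset.mem_union_left _ hk)).1
  refine ⟨k + x, fun f hf => ?_⟩
  obtain ⟨hT, t, ht, hA⟩ :=
    hx (f + k) (Finset.mem_union_right _ (Finset.mem_image₂_of_mem hf hk))
  rw [add_assoc] at hT hA
  refine ⟨hT, t, ht, hA.resolve_right fun hB => ?_⟩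
  refine hkB (t + f) (Finset.mem_image₂_of_mem ht hf) ?_
  rwa [add_assoc]

/-- Piecewise syndeticity is partition regular. -/
theorem exists_of_cover {ι : Type*} (s : Finset ι) (C : ι → Set R) :
    ∀ {A : Set R}, RelPiecewiseSyndetic T A → (∀ z ∈ A, ∃ i ∈ s, z ∈ C i) →
      ∃ i ∈ s, RelPiecewiseSyndetic T (A ∩ C i) := by
  classical
  induction s using Finset.induction_on with
  | empty =>
    intro A h hC
    obtain ⟨z, hz⟩ := h.nonempty
    simpa using hC z hz
  | insert a s _ ih =>
    intro A h hC
    have hsub : A ⊆ (A ∩ C a) ∪ (A \ C a) := (Set.inter_union_sdiff A (C a)).ge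
    rcases (h.mono hsub).union with h1 | h1
    · exact ⟨a, Finset.mem_insert_self _ _, h1⟩
    · obtain ⟨i, hi, h2⟩ := ih h1 (by
        rintro z ⟨hzA, hza⟩
        obtain ⟨i, hi, hz⟩ := hC z hzA
        rcases Finset.mem_insert.1 hi with rfl | hi
        · exact absurd hz hza
        · exact ⟨i, hi, hz⟩)
      exact ⟨i, Finset.mem_insert_of_mem hi, h2.mono fun z hz => ⟨hz.1.1, hz.2⟩⟩

end Group

end RelPiecewiseSyndetic

section PET

variable {R : Type*} [CommRing R]

open Classical in
/-- The distinct pairs (degree, leading coefficient) of the nonzero members of `F`. -/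
noncomputable def leadingData (F : Finset R[X]) : Finset (ℕ × R) :=
  (F.filter (· ≠ 0)).image fun f => (f.natDegree, f.leadingCoeff)

/-- The weight of a finite family of polynomials used for PET induction: the degrees occurring in
the family, each counted once for every leading coefficient it occurs with. -/
noncomputable def petWeight (F : Finset R[X]) : Multiset ℕ :=
  (leadingData F).val.map Prod.fst

theorem coeff_natDegree_taylor_sub_C {f : R[X]} (hf : 0 < f.natDegree) (u c : R) :
    (taylor u f - C c).coeff f.natDegree = f.leadingCoeff := by
  rw [coeff_sub, coeff_C_of_ne_zero hf.ne', sub_zero, coeff_taylor_natDegree]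

open Classical in
/-- Shifting a family and subtracting a member of minimal degree decreases the PET weight. -/
theorem petWeight_lt {F F' : Finset R[X]} {p : R[X]} (hp : p ∈ F) (hdeg : 0 < p.natDegree)
    (hmin : ∀ f ∈ F, p.natDegree ≤ f.natDegree)
    (hF' : ∀ g ∈ F', ∃ f ∈ F, ∃ u c : R, g = taylor u f - C c - p) :
    Multiset.IsDershowitzMannaLT (petWeight F') (petWeight F) := by
  set d := p.natDegree with hd
  set a := p.leadingCoeff with ha
  have hp0 : p ≠ 0 := ne_zero_of_natDegree_gt hdeg
  have hmem : (d, a) ∈ leadingData F :=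
    Finset.mem_image.2 ⟨p, Finset.mem_filter.2 ⟨hp, hp0⟩, rfl⟩
  let φ : ℕ × R → ℕ × R := fun q => if q.1 = d then (q.1, q.2 - a) else q
  have hφ : ∀ q, (φ q).1 = q.1 := fun q => by
    by_cases h : q.1 = d <;> simp [φ, h]
  have key : (leadingData F').filter (d ≤ ·.1) ⊆ ((leadingData F).erase (d, a)).image φ := by
    intro q hq
    obtain ⟨hq, hdq⟩ := Finset.mem_filter.1 hq
    obtain ⟨g, hg, rfl⟩ := Finset.mem_image.1 hq
    obtain ⟨hgF, hg0⟩ := Finset.mem_filter.1 hg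
    obtain ⟨f, hf, u, c, rfl⟩ := hF' g hgF
    have hfd := hmin f hf
    have hfpos : 0 < f.natDegree := hdeg.trans_le hfd
    have hf0 : f ≠ 0 := ne_zero_of_natDegree_gt hfpos
    have hfmem : (f.natDegree, f.leadingCoeff) ∈ leadingData F :=
      Finset.mem_image.2 ⟨f, Finset.mem_filter.2 ⟨hf, hf0⟩, rfl⟩
    have hlc := coeff_natDegree_taylor_sub_C hfpos u c
    have hnd : (taylor u f - C c).natDegree = f.natDegree := by
      rw [natDegree_sub_C, natDegree_taylor]
    dsimp only at hdq ⊢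
    rcases hfd.lt_or_eq with hlt | heq
    · have h1 : (taylor u f - C c - p).natDegree = f.natDegree := by
        rw [natDegree_sub_eq_left_of_natDegree_lt (by rw [hnd]; exact hlt), hnd]
      have h2 : (taylor u f - C c - p).leadingCoeff = f.leadingCoeff := by
        rw [leadingCoeff, h1, coeff_sub, hlc, coeff_eq_zero_of_natDegree_lt hlt, sub_zero]
      rw [h1, h2]
      refine Finset.mem_image.2 ⟨_, Finset.mem_erase.2 ⟨?_, hfmem⟩, ?_⟩
      · intro h
        exact hlt.ne' (Prod.ext_iff.1 h).1
      · simp [φ, hlt.ne']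
    · have hle : (taylor u f - C c - p).natDegree ≤ d :=
        (natDegree_sub_le _ _).trans (by rw [hnd, ← heq, max_self])
      have h1 : (taylor u f - C c - p).natDegree = d := le_antisymm hle hdq
      have h2 : (taylor u f - C c - p).leadingCoeff = f.leadingCoeff - a := by
        rw [leadingCoeff, h1, coeff_sub, ← hlc, ← heq, ha, leadingCoeff]
      rw [h1, h2]
      refine Finset.mem_image.2 ⟨_, Finset.mem_erase.2 ⟨?_, hfmem⟩, ?_⟩
      · intro h
        have : f.leadingCoeff = a := (Prod.ext_iff.1 h).2
        rw [this, sub_self] at h2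
        exact hg0 (leadingCoeff_eq_zero.1 h2)
      · simp [φ, ← heq]
  have hle : ((leadingData F').filter (d ≤ ·.1)).val.map Prod.fst ≤
      ((leadingData F).erase (d, a)).val.map Prod.fst := by
    calc _ ≤ (((leadingData F).erase (d, a)).image φ).val.map Prod.fst :=
          Multiset.map_le_map (Finset.val_le_iff.2 key)
      _ ≤ (((leadingData F).erase (d, a)).val.map φ).map Prod.fst :=
          Multiset.map_le_map (Multiset.dedup_le _)
      _ = _ := by
          rw [Multiset.map_map]
          exact Multiset.map_congr rfl fun q _ => hφ q
  obtain ⟨Z, hZ⟩ := Multiset.le_iff_exists_add.1 hle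
  refine ⟨((leadingData F').filter (d ≤ ·.1)).val.map Prod.fst,
    ((leadingData F').filter (¬ d ≤ ·.1)).val.map Prod.fst, d ::ₘ Z, Multiset.cons_ne_zero,
    ?_, ?_, ?_⟩
  · rw [petWeight, ← Multiset.map_add, Finset.filter_val, Finset.filter_val,
      Multiset.filter_add_not]
  · rw [Multiset.add_cons, ← hZ, petWeight, ← Finset.insert_erase hmem,
      Finset.insert_val_of_notMem (Finset.notMem_erase _ _), Multiset.map_cons,
      Finset.erase_insert (Finset.notMem_erase _ _)]
  · intro y hy
    obtain ⟨q, hq, rfl⟩ := Multiset.mem_map.1 hy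
    exact ⟨d, Multiset.mem_cons_self _ _, not_le.1 (Finset.mem_filter.1 hq).2⟩

end PET

/-- `F` is polynomially recurrent for piecewise syndetic sets: inside every piecewise syndetic `A`
there are piecewise syndetically many `z` with `z + f(y) ∈ A` for all `f ∈ F`, for some `y` outside
any prescribed finite set. -/
def IsPSRecurrent {R : Type*} [CommRing R] (F : Finset R[X]) : Prop :=
  ∀ (T A : Set R) (E : Finset R), RelPiecewiseSyndetic T A →
    ∃ y ∉ E, RelPiecewiseSyndetic T {z | z ∈ A ∧ ∀ f ∈ F, z + f.eval y ∈ A}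

/-- The colour-focusing step of the polynomial van der Waerden theorem. -/
theorem IsPSRecurrent.of_shifts {R : Type*} [CommRing R] {F : Finset R[X]} {p : R[X]}
    (hF0 : ∀ f ∈ F, f.eval 0 = 0)
    (hrec : ∀ F' : Finset R[X],
      (∀ g ∈ F', ∃ f ∈ F, ∃ u : R, g = taylor u f - C (f.eval u) - p) → IsPSRecurrent F') :
    IsPSRecurrent F := by
  classical
  intro T A E hA
  by_contra! hbad
  obtain ⟨G, hG⟩ := hA
  set T' : Set R := {z | z ∈ T ∧ ∃ t ∈ G, t + z ∈ A}
  have hT'T : T' ⊆ T := fun z hz => hz.1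
  have focus : ∀ n : ℕ, ∃ (K : Finset R) (u : R → R) (B : Set R), K ⊆ G ∧ K.card = n ∧
      RelPiecewiseSyndetic T' B ∧ ∀ t ∈ K, ∀ z ∈ B, ∀ f ∈ F, t + (z + f.eval (u t)) ∈ A := by
    intro n
    induction n with
    | zero =>
      refine ⟨∅, id, Set.univ, by simp, by simp, ⟨{0}, fun H => ?_⟩, by simp⟩
      obtain ⟨x, hx⟩ := hG H
      exact ⟨x, fun f hf => ⟨hx f hf, 0, by simp, trivial⟩⟩
    | succ n ih =>
      obtain ⟨K, u, B, hKG, hK, hB, hBA⟩ := ih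
      let shift : R[X] → R → R[X] := fun f t => taylor (u t) f - C (f.eval (u t)) - p
      obtain ⟨y, hyE, hD⟩ := hrec (Finset.image₂ shift F K) (by
        intro g hg
        obtain ⟨f, hf, t, -, rfl⟩ := Finset.mem_image₂.1 hg
        exact ⟨f, hf, u t, rfl⟩) T' B (Finset.image₂ (fun e t => e - u t) E K) hB
      obtain ⟨s, hs, hB'⟩ := (hD.translate (p.eval y)).inter_left.exists_of_cover G
        (fun t => {z | t + z ∈ A}) (fun z hz => hz.2.2)
      have hshift : ∀ t ∈ K, ∀ z, (p.eval y + z ∈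
          {z | z ∈ B ∧ ∀ g ∈ Finset.image₂ shift F K, z + g.eval y ∈ B}) →
          ∀ f ∈ F, t + (z + f.eval (y + u t)) ∈ A := by
        intro t ht z hz f hf
        have h1 := hz.2 _ (Finset.mem_image₂_of_mem hf ht)
        have h2 := hBA t ht _ h1 f hf
        have h3 : p.eval y + z + (shift f t).eval y + f.eval (u t) = z + f.eval (y + u t) := by
          simp only [shift, eval_sub, eval_C, taylor_eval]
          ring
        rwa [h3] at h2
      by_cases hsK : s ∈ K
      · refine absurd ?_ (hbad (y + u s) fun h => hyE ?_)
        · refine ((hB'.translate (-s)).mono_left hT'T).mono ?_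
          rintro z ⟨⟨hz, -⟩, hz'⟩
          refine ⟨by simpa using hz', fun f hf => ?_⟩
          have := hshift s hsK _ hz f hf
          rwa [← add_assoc, add_neg_cancel_left] at this
        · exact Finset.mem_image₂.2 ⟨_, h, s, hsK, by ring⟩
      · refine ⟨insert s K, Function.update (fun t => y + u t) s 0, _, ?_, ?_, hB', ?_⟩
        · exact Finset.insert_subset hs hKG
        · rw [Finset.card_insert_of_notMem hsK, hK]
        · rintro t ht z ⟨⟨hz, -⟩, hz'⟩ f hf
          rcases Finset.mem_insert.1 ht with rfl | ht
          · rw [Function.update_self, hF0 f hf, add_zero]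
            exact hz'
          · rw [Function.update_of_ne (ne_of_mem_of_not_mem ht hsK)]
            exact hshift t ht z hz f hf
  obtain ⟨K, -, -, hKG, hK, -⟩ := focus (G.card + 1)
  have := Finset.card_le_card hKG
  omega

/-- Polynomial van der Waerden theorem for piecewise syndetic subsets of an infinite ring. -/
theorem isPSRecurrent {R : Type*} [CommRing R] [Infinite R] (F : Finset R[X])
    (hF0 : ∀ f ∈ F, f.eval 0 = 0) : IsPSRecurrent F := by
  classical
  induction hw : petWeight F using
    (Multiset.wellFounded_isDershowitzMannaLT (α := ℕ)).induction generalizing F with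
  | _ w ih =>
  subst hw
  by_cases hF : ∃ f ∈ F, f ≠ 0
  · have hne : (F.filter (· ≠ 0)).Nonempty :=
      hF.imp fun f hf => Finset.mem_filter.2 hf
    obtain ⟨p, hp, hmin⟩ := Finset.exists_min_image _ natDegree hne
    have hpF := Finset.mem_filter.1 hp
    have hdeg : 0 < p.natDegree := by
      rw [Nat.pos_iff_ne_zero]
      intro h
      have h0 := hF0 p hpF.1
      rw [eq_C_of_natDegree_eq_zero h, eval_C] at h0
      rw [eq_C_of_natDegree_eq_zero h, h0, C_0] at hpF
      exact hpF.2 rfl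
    have hrec : IsPSRecurrent (F.filter (· ≠ 0)) := by
      refine .of_shifts (p := p) (fun f hf => hF0 f (Finset.mem_filter.1 hf).1) fun F' hF' => ?_
      refine ih _ ?_ F' ?_ rfl
      · have := petWeight_lt (F' := F') hp hdeg hmin fun g hg => by
          obtain ⟨f, hf, u, rfl⟩ := hF' g hg
          exact ⟨f, hf, u, _, rfl⟩
        rwa [show petWeight (F.filter (· ≠ 0)) = petWeight F by
          simp [petWeight, leadingData, Finset.filter_filter]] at this
      · intro g hg
        obtain ⟨f, hf, u, rfl⟩ := hF' g hg
        simp [taylor_eval, hF0 p hpF.1]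
    intro T A E hA
    obtain ⟨y, hy, h⟩ := hrec T A E hA
    refine ⟨y, hy, h.mono fun z hz => ⟨hz.1, fun f hf => ?_⟩⟩
    by_cases hf0 : f = 0
    · simpa [hf0] using hz.1
    · exact hz.2 f (Finset.mem_filter.2 ⟨hf, hf0⟩)
  · push Not at hF
    intro T A E hA
    obtain ⟨y, hy⟩ := Infinite.exists_notMem_finset E
    refine ⟨y, hy, hA.mono fun z hz => ⟨hz, fun f hf => ?_⟩⟩
    simpa [hF f hf] using hz

section Dilation

variable {R : Type*} [CommRing R]

theorem exists_finset_add_mul_eq {y : R}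
    (hy : (Ideal.span {y}).toAddSubgroup.index ≠ 0) :
    ∃ K : Finset R, ∀ x : R, ∃ k ∈ K, ∃ w, x = k + y * w := by
  classical
  have : (Ideal.span {y}).toAddSubgroup.FiniteIndex := ⟨hy⟩
  have : Finite (R ⧸ (Ideal.span {y}).toAddSubgroup) :=
    AddSubgroup.finite_quotient_of_finiteIndex
  have := Fintype.ofFinite (R ⧸ (Ideal.span {y}).toAddSubgroup)
  refine ⟨Finset.univ.image (Quotient.out : R ⧸ (Ideal.span {y}).toAddSubgroup → R),
    fun x => ⟨_, Finset.mem_image_of_mem _ (Finset.mem_univ (QuotientAddGroup.mk x)), ?_⟩⟩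
  have h : -(Quotient.out (QuotientAddGroup.mk x : R ⧸ (Ideal.span {y}).toAddSubgroup)) + x ∈
      (Ideal.span {y}).toAddSubgroup := by
    rw [← QuotientAddGroup.eq]
    exact Quotient.out_eq _
  obtain ⟨w, hw⟩ := Ideal.mem_span_singleton'.1 h
  exact ⟨w, by rw [mul_comm, hw]; abel⟩

theorem PiecewiseSyndetic.image_mul_left {y : R} {A : Set R}
    (hy : (Ideal.span {y}).toAddSubgroup.index ≠ 0) (h : PiecewiseSyndetic A) :
    PiecewiseSyndetic ((y * ·) '' A) := by
  classical
  obtain ⟨K, hK⟩ := exists_finset_add_mul_eq hy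
  choose κ hκ q hq using hK
  obtain ⟨G, hG⟩ := h
  refine ⟨Finset.image₂ (fun t k => y * t - k) G K, fun F => ?_⟩
  obtain ⟨x, hx⟩ := hG (F.image q)
  refine ⟨y * x, fun f hf => ?_⟩
  obtain ⟨t, ht, hA⟩ := hx _ (Finset.mem_image_of_mem q hf)
  refine ⟨_, Finset.mem_image₂_of_mem ht (hκ f), _, hA, ?_⟩
  linear_combination -hq f

theorem PiecewiseSyndetic.preimage_mul_left [IsDomain R] {y : R} {B : Set R} (hy0 : y ≠ 0)
    (hy : (Ideal.span {y}).toAddSubgroup.index ≠ 0) (h : PiecewiseSyndetic B)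
    (hB : ∀ z ∈ B, y ∣ z) : PiecewiseSyndetic {x | y * x ∈ B} := by
  classical
  obtain ⟨K, hK⟩ := exists_finset_add_mul_eq hy
  obtain ⟨G, hG⟩ := h
  refine ⟨(Finset.image₂ (· + ·) G K).preimage (y * ·) (mul_right_injective₀ hy0).injOn,
    fun F => ?_⟩
  obtain ⟨x, hx⟩ := hG (F.image (y * ·))
  obtain ⟨k, hk, w, rfl⟩ := hK x
  refine ⟨w, fun f hf => ?_⟩
  obtain ⟨t, ht, htB⟩ := hx _ (Finset.mem_image_of_mem _ hf)
  obtain ⟨v, hv⟩ := hB _ htB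
  have hs : y * (v - f - w) = t + k := by linear_combination -hv
  refine ⟨v - f - w, Finset.mem_preimage.2 ?_, ?_⟩
  · rw [hs]
    exact Finset.mem_image₂_of_mem ht hk
  · rw [hv] at htB
    have : v - f - w + (f + w) = v := by ring
    rwa [Set.mem_ofPred_eq, this]

end Dilation

/-- In a finite colouring of a large ideal domain, some `y` outside any given finite set has
piecewise syndetically many `x` for which `xy` and all `x + f(y)` receive the same colour. -/
theorem exists_piecewiseSyndetic_mul_add_eval {R : Type*} [CommRing R] [IsDomain R] [Infinite R]
    (hLID : ∀ I : Ideal R, I ≠ ⊥ → (I.toAddSubgroup).index ≠ 0)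
    {ι : Type*} [Fintype ι] (F : Finset R[X]) (hF : ∀ f ∈ F, f.eval 0 = 0)
    (C : ι → Set R) (hcover : ∀ z, ∃ i, z ∈ C i) (E : Finset R) :
    ∃ i, ∃ y ∉ E, PiecewiseSyndetic {x : R | x * y ∈ C i ∧ ∀ f ∈ F, x + f.eval y ∈ C i} := by
  classical
  by_contra! hbad
  have hind : ∀ y : R, y ≠ 0 → (Ideal.span {y}).toAddSubgroup.index ≠ 0 := fun y hy =>
    hLID _ (by simpa using hy)
  have chain : ∀ n : ℕ, ∃ (K : Finset ι) (q : ι → R) (B : Set R), K.card = n ∧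
      (∀ t, q t ≠ 0) ∧ PiecewiseSyndetic B ∧ ∀ t ∈ K, ∀ z ∈ B, ∃ w ∈ C t, z = q t * w := by
    intro n
    induction n with
    | zero => exact ⟨∅, fun _ => 1, Set.univ, by simp, by simp, ⟨{0}, by simp⟩, by simp⟩
    | succ n ih =>
      obtain ⟨K, q, B, hK, hq, hB, hBC⟩ := ih
      let dil : R[X] → ι → R[X] := fun f t => Polynomial.C (q t) * f.comp (Polynomial.C (q t) * X)
      obtain ⟨y, hyE, hD⟩ := isPSRecurrent (Finset.image₂ dil F K) (by
        intro g hg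
        obtain ⟨f, hf, t, -, rfl⟩ := Finset.mem_image₂.1 hg
        simp [dil, hF f hf]) Set.univ B
        (insert 0 (K.biUnion fun t => E.preimage (q t * ·) (mul_right_injective₀ (hq t)).injOn))
        (RelPiecewiseSyndetic.univ_iff.2 hB)
      simp only [Finset.mem_insert, Finset.mem_biUnion, Finset.mem_preimage, not_or, not_exists,
        not_and] at hyE
      obtain ⟨hy0, hyE⟩ := hyE
      have hyD := (RelPiecewiseSyndetic.univ_iff.1 hD).image_mul_left (hind y hy0)
      obtain ⟨s, -, hB'⟩ := (RelPiecewiseSyndetic.univ_iff.2 hyD).exists_of_cover Finset.univ C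
        fun z _ => by simpa using hcover z
      rw [RelPiecewiseSyndetic.univ_iff] at hB'
      by_cases hsK : s ∈ K
      · refine absurd ?_ (hbad s (q s * y) (hyE s hsK))
        have hqy : q s * y ≠ 0 := mul_ne_zero (hq s) hy0
        have hdvd : ∀ z ∈ B, q s ∣ z := fun z hz => by
          obtain ⟨w, -, rfl⟩ := hBC s hsK z hz
          exact dvd_mul_right _ _
        have hB'' := hB'.preimage_mul_left hqy (hind _ hqy) (by
          rintro _ ⟨⟨z, hz, rfl⟩, -⟩
          obtain ⟨w, rfl⟩ := hdvd z hz.1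
          exact ⟨w, by ring⟩)
        rw [← RelPiecewiseSyndetic.univ_iff] at hB'' ⊢
        refine hB''.mono ?_
        rintro x ⟨⟨z, hz, hzx⟩, hx⟩
        refine ⟨by rwa [mul_comm], fun f hf => ?_⟩
        have hzx : z = q s * x := mul_left_cancel₀ hy0 (by
          simp only at hzx
          rw [hzx]
          ring)
        obtain ⟨w, hw, h⟩ := hBC s hsK _ (hz.2 _ (Finset.mem_image₂_of_mem hf hsK))
        have : x + f.eval (q s * y) = w := mul_left_cancel₀ (hq s) (by
          rw [← h, hzx]
          simp only [dil, eval_mul, eval_C, eval_comp, eval_X]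
          ring)
        rwa [this]
      · refine ⟨insert s K, Function.update (fun t => y * q t) s 1, _, ?_, ?_, hB', ?_⟩
        · rw [Finset.card_insert_of_notMem hsK, hK]
        · intro t
          by_cases hts : t = s
          · simp [hts]
          · simp [hts, hy0, hq t]
        · rintro t ht _ ⟨⟨z, hz, rfl⟩, hz'⟩
          rcases Finset.mem_insert.1 ht with rfl | ht
          · exact ⟨_, hz', by simp⟩
          · obtain ⟨w, hw, rfl⟩ := hBC t ht z hz.1
            refine ⟨w, hw, ?_⟩
            rw [Function.update_of_ne (ne_of_mem_of_not_mem ht hsK)]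
            ring
  obtain ⟨K, -, -, hK, -⟩ := chain (Fintype.card ι + 1)
  have := K.card_le_univ
  omega

/-- Polynomial Hindman–Strauss-type refinement of Moreira's theorem for LIDs: there are a color
`i` and infinitely many `y` such that `{x : {xy} ∪ {x+f(y) : f ∈ F} ⊆ C i}` is piecewise
syndetic. -/
theorem stmt_14 {R : Type*} [CommRing R] [IsDomain R] [Infinite R]
    (hLID : ∀ I : Ideal R, I ≠ ⊥ → (I.toAddSubgroup).index ≠ 0)
    (r : ℕ) (F : Finset (Polynomial R)) (hF : ∀ f ∈ F, f.coeff 0 = 0)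
    (C : Fin r → Set R) (hcover : (⋃ i, C i) = Set.univ) :
    ∃ i : Fin r,
      Set.Infinite {y : R | PiecewiseSyndetic
        {x : R | x * y ∈ C i ∧ ∀ f ∈ F, x + f.eval y ∈ C i}} := by
  by_contra! hfin
  obtain ⟨i, y, hy, h⟩ := exists_piecewiseSyndetic_mul_add_eval hLID F
    (fun f hf => by rw [← coeff_zero_eq_eval_zero, hF f hf]) C
    (fun z => Set.mem_iUnion.1 (hcover ▸ Set.mem_univ z)) (Set.finite_iUnion hfin).toFinset
  exact hy ((Set.finite_iUnion hfin).mem_toFinset.2 (Set.mem_iUnion.2 ⟨i, h⟩))
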